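/- arXiv:2011.14977 — 3 statements merged into one kernel-verified Lean document; each statement's English description precedes it below -/
import Mathlib

section
/- Let n ≥ 2, let b : {0,…,n−1} × {0,…,n−1} → ℝ be symmetric susceptances, and suppose the underlying graph is bipartite with parts S and T partitioning {0,…,n−1}, where 0 ∈ T and b_{km} = 0 whenever k and m lie in the same part. If (x, y) = (x_1,…,x_{n−1}, y_1,…,y_{n−1}) ∈ ℂ^{2(n−1)} is a solution of the zero-injection power flow equations (with x_0 = 1, y_0 = 0), then the tuple (x', y') defined by x'_k = −x_k for k ∈ S, x'_k = x_k for k ∈ T∖{0}, y'_k = y_k for k ∈ S, and y'_k = −y_k for k ∈ T∖{0}, is also a solution. -/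
/-- For a bipartite network with parts `S`, `T` (with `0 ∈ T`),
if `(x, y)` solves the zero-injection power flow equations, then so does
the tuple obtained by negating `x` on `S` and negating `y` on `T \ {0}`
(keeping the reference values `x 0 = 1`, `y 0 = 0`, i.e. the new tuple is
`x' k = -x k, y' k = y k` for `k ∈ S` and `x' k = x k, y' k = -y k` for `k ∈ T`). -/
theorem powerflow_bipartite_symmetry_one (n : ℕ) (hn : 2 ≤ n)
    (b : Fin n → Fin n → ℝ) (hb : ∀ k m, b k m = b m k)
    (S T : Finset (Fin n)) (hST : Disjoint S T) (hUnion : S ∪ T = Finset.univ)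
    (h0T : (⟨0, by omega⟩ : Fin n) ∈ T)
    (hbip : ∀ k m : Fin n, (k ∈ S ∧ m ∈ S) ∨ (k ∈ T ∧ m ∈ T) → b k m = 0)
    (x y : Fin n → ℂ)
    (hx0 : x ⟨0, by omega⟩ = 1) (hy0 : y ⟨0, by omega⟩ = 0)
    (hcirc : ∀ k : Fin n, k ≠ ⟨0, by omega⟩ → (x k) ^ 2 + (y k) ^ 2 = 1)
    (hbal : ∀ k : Fin n, k ≠ ⟨0, by omega⟩ →
      ∑ m : Fin n, (b k m : ℂ) * (x k * y m - x m * y k) = 0) :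
    (if (⟨0, by omega⟩ : Fin n) ∈ S then -x ⟨0, by omega⟩ else x ⟨0, by omega⟩) = 1 ∧
    (if (⟨0, by omega⟩ : Fin n) ∈ S then y ⟨0, by omega⟩ else -y ⟨0, by omega⟩) = 0 ∧
    (∀ k : Fin n, k ≠ ⟨0, by omega⟩ →
      (if k ∈ S then -x k else x k) ^ 2 + (if k ∈ S then y k else -y k) ^ 2 = 1) ∧
    (∀ k : Fin n, k ≠ ⟨0, by omega⟩ →
      ∑ m : Fin n, (b k m : ℂ) *
        ((if k ∈ S then -x k else x k) * (if m ∈ S then y m else -y m)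
          - (if m ∈ S then -x m else x m) * (if k ∈ S then y k else -y k)) = 0) := by
  have h0S : (⟨0, by omega⟩ : Fin n) ∉ S := fun h => Finset.disjoint_left.mp hST h h0T
  have hT : ∀ k, k ∉ S → k ∈ T := fun k hk =>
    (Finset.mem_union.mp (hUnion ▸ Finset.mem_univ k)).resolve_left hk
  refine ⟨by rw [if_neg h0S, hx0], by rw [if_neg h0S, hy0, neg_zero], fun k hk => ?_,
    fun k hk => ?_⟩
  · rw [← hcirc k hk]
    split_ifs <;> ring
  · rw [← hbal k hk]
    refine Finset.sum_congr rfl fun m _ => ?_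
    by_cases hkS : k ∈ S <;> by_cases hmS : m ∈ S
    · simp [hbip k m (Or.inl ⟨hkS, hmS⟩)]
    · simp only [hkS, hmS, if_true, if_false]
      ring
    · simp only [hkS, hmS, if_true, if_false]
      ring
    · simp [hbip k m (Or.inr ⟨hT k hkS, hT m hmS⟩)]
end

section
/- Let n ≥ 2, let b : {0,…,n−1} × {0,…,n−1} → ℝ be symmetric susceptances, and suppose the underlying graph is bipartite with parts S and T partitioning {0,…,n−1}, where 0 ∈ T and b_{km} = 0 whenever k and m lie in the same part. If (x, y) = (x_1,…,x_{n−1}, y_1,…,y_{n−1}) ∈ ℂ^{2(n−1)} is a solution of the zero-injection power flow equations (with x_0 = 1, y_0 = 0), then the tuple (x', y') defined by x'_k = −x_k and y'_k = −y_k for k ∈ S, and x'_k = x_k, y'_k = y_k for k ∈ T∖{0}, is also a solution. -/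
/-- For a bipartite network with parts `S`, `T` (with `0 ∈ T`),
if `(x, y)` solves the zero-injection power flow equations, then so does
the tuple obtained by negating both `x` and `y` on `S` and keeping them on `T`
(the reference values `x 0 = 1`, `y 0 = 0` are preserved since `0 ∈ T`). -/
theorem powerflow_bipartite_symmetry_two (n : ℕ) (hn : 2 ≤ n)
    (b : Fin n → Fin n → ℝ) (hb : ∀ k m, b k m = b m k)
    (S T : Finset (Fin n)) (hST : Disjoint S T) (hUnion : S ∪ T = Finset.univ)
    (h0T : (⟨0, by omega⟩ : Fin n) ∈ T)
    (hbip : ∀ k m : Fin n, (k ∈ S ∧ m ∈ S) ∨ (k ∈ T ∧ m ∈ T) → b k m = 0)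
    (x y : Fin n → ℂ)
    (hx0 : x ⟨0, by omega⟩ = 1) (hy0 : y ⟨0, by omega⟩ = 0)
    (hcirc : ∀ k : Fin n, k ≠ ⟨0, by omega⟩ → (x k) ^ 2 + (y k) ^ 2 = 1)
    (hbal : ∀ k : Fin n, k ≠ ⟨0, by omega⟩ →
      ∑ m : Fin n, (b k m : ℂ) * (x k * y m - x m * y k) = 0) :
    (if (⟨0, by omega⟩ : Fin n) ∈ S then -x ⟨0, by omega⟩ else x ⟨0, by omega⟩) = 1 ∧
    (if (⟨0, by omega⟩ : Fin n) ∈ S then -y ⟨0, by omega⟩ else y ⟨0, by omega⟩) = 0 ∧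
    (∀ k : Fin n, k ≠ ⟨0, by omega⟩ →
      (if k ∈ S then -x k else x k) ^ 2 + (if k ∈ S then -y k else y k) ^ 2 = 1) ∧
    (∀ k : Fin n, k ≠ ⟨0, by omega⟩ →
      ∑ m : Fin n, (b k m : ℂ) *
        ((if k ∈ S then -x k else x k) * (if m ∈ S then -y m else y m)
          - (if m ∈ S then -x m else x m) * (if k ∈ S then -y k else y k)) = 0) := by
  have h0S : (⟨0, by omega⟩ : Fin n) ∉ S := fun h => Finset.disjoint_left.mp hST h h0T
  have mem_T : ∀ k, k ∉ S → k ∈ T := fun k hk =>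
    (Finset.mem_union.mp (hUnion ▸ Finset.mem_univ k)).resolve_left hk
  refine ⟨by rw [if_neg h0S, hx0], by rw [if_neg h0S, hy0], fun k hk => ?_, fun k hk => ?_⟩
  · split_ifs <;> simpa using hcirc k hk
  · rw [← neg_eq_zero, ← Finset.sum_neg_distrib, ← hbal k hk]
    refine Finset.sum_congr rfl fun m _ => ?_
    by_cases hkS : k ∈ S <;> by_cases hmS : m ∈ S
    · simp [hbip k m (Or.inl ⟨hkS, hmS⟩)]
    · simp only [if_pos hkS, if_neg hmS]
      ring
    · simp only [if_neg hkS, if_pos hmS]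
      ring
    · simp [hbip k m (Or.inr ⟨mem_T k hkS, mem_T m hmS⟩)]
end

section
/- Let G be a connected simple graph on the vertex set {0,1,…,n−1} with n ≥ 2 and with at least n edges. Set t_0 = 1 and let t_1,…,t_{n−1} ∈ ℂ satisfy: 1 + t_k² ≠ 0 for all k ∈ {0,…,n−1}, and for every edge {k,m} of G, t_k ≠ t_m and t_k t_m ≠ −1. Then there exist symmetric susceptances b : {0,…,n−1} × {0,…,n−1} → ℂ, not all zero, with b_{km} = 0 whenever {k,m} is not an edge of G, such that the point x_k = 2t_k/(1 + t_k²), y_k = (1 − t_k²)/(1 + t_k²) for k = 1,…,n−1 (note x_0 = 1, y_0 = 0 since t_0 = 1) satisfies the zero-injection power balance equations: for every k = 1,…,n−1, Σ_{m=0}^{n−1} b_{km}(x_k y_m − x_m y_k) = 0. -/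
/-- If a finite graph has at least as many edges as vertices, then edge weights can be chosen, not
all zero, that satisfy one homogeneous linear equation at every vertex other than `v`. -/
theorem exists_ne_zero_edge_weights {V K : Type*} [Fintype V] [Field K] (G : SimpleGraph V)
    (hE : Fintype.card V ≤ G.edgeSet.ncard) (v : V) (c : V → V → K) :
    ∃ b : V → V → K, b ≠ 0 ∧ (∀ k m, b k m = b m k) ∧ (∀ k m, ¬ G.Adj k m → b k m = 0) ∧
      ∀ k, k ≠ v → ∑ m, b k m * c k m = 0 := by
  classical
  let w : (G.edgeSet → K) →ₗ[K] V → V → K :=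
    { toFun := fun f k m => if h : s(k, m) ∈ G.edgeSet then f ⟨s(k, m), h⟩ else 0
      map_add' := fun f g => by ext k m; by_cases h : G.Adj k m <;> simp [h]
      map_smul' := fun a f => by ext k m; by_cases h : G.Adj k m <;> simp [h] }
  let L : (G.edgeSet → K) →ₗ[K] {k // k ≠ v} → K :=
    { toFun := fun f k => ∑ m, w f k m * c k m
      map_add' := fun f g => by ext k; simp [add_mul, Finset.sum_add_distrib]
      map_smul' := fun a f => by ext k; simp [mul_assoc, Finset.mul_sum] }
  have hlt : Module.finrank K ({k // k ≠ v} → K) < Module.finrank K (G.edgeSet → K) := by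
    rw [Module.finrank_fintype_fun_eq_card, Module.finrank_fintype_fun_eq_card,
      ← Nat.card_eq_fintype_card (α := G.edgeSet), Nat.card_coe_set_eq]
    exact (Fintype.card_subtype_lt (x := v) (by simp)).trans_le hE
  obtain ⟨f, hf, hf0⟩ := (Submodule.ne_bot_iff _).1 (L.ker_ne_bot_of_finrank_lt hlt)
  refine ⟨w f, fun hw => hf0 ?_, fun k m => ?_, fun k m h => ?_, fun k hk => ?_⟩
  · ext ⟨e, he⟩
    induction e using Sym2.ind with
    | _ k m => simpa [w, show G.Adj k m from he] using congrFun (congrFun hw k) m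
  · simp only [w, LinearMap.coe_mk, AddHom.coe_mk, Sym2.eq_swap (a := k)]
  · exact dif_neg h
  · exact congrFun (LinearMap.mem_ker.1 hf) ⟨k, hk⟩


/-- For a connected simple graph `G` on `{0, …, n-1}` (`n ≥ 2`)
with at least `n` edges, and generic parameters `t` on the unit circle
parametrization (`t 0 = 1`, `1 + t_k² ≠ 0`, and `t_k ≠ t_m`, `t_k t_m ≠ -1`
across each edge), there exist symmetric susceptances `b`, not all zero,
supported on the edges of `G`, such that the parametrized point
`x_k = 2 t_k / (1 + t_k²)`, `y_k = (1 - t_k²) / (1 + t_k²)` satisfies the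
zero-injection power balance equations. -/
theorem powerflow_fiber_nonempty (n : ℕ) (hn : 2 ≤ n)
    (G : SimpleGraph (Fin n)) (hG : G.Connected)
    (hE : n ≤ G.edgeSet.ncard)
    (t : Fin n → ℂ) (ht0 : t ⟨0, by omega⟩ = 1)
    (htsq : ∀ k : Fin n, 1 + (t k) ^ 2 ≠ 0)
    (htE : ∀ k m : Fin n, G.Adj k m → t k ≠ t m ∧ t k * t m ≠ -1) :
    ∃ b : Fin n → Fin n → ℂ, b ≠ 0 ∧
      (∀ k m : Fin n, b k m = b m k) ∧
      (∀ k m : Fin n, ¬ G.Adj k m → b k m = 0) ∧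
      (∀ k : Fin n, k ≠ ⟨0, by omega⟩ →
        ∑ m : Fin n, b k m *
          ((2 * t k / (1 + (t k) ^ 2)) * ((1 - (t m) ^ 2) / (1 + (t m) ^ 2))
            - (2 * t m / (1 + (t m) ^ 2)) * ((1 - (t k) ^ 2) / (1 + (t k) ^ 2))) = 0) := by
  exact exists_ne_zero_edge_weights G (by simpa using hE) _ _
end
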